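/- Every complex m×n matrix X has both a Schur factorization and a bilinear Schur factorization. That is, there exist (F, W, G) with F a positive semidefinite m×m matrix each diagonal entry of F² being at most 1, G a positive semidefinite n×n matrix each diagonal entry of G² being at most 1, W an m×n partial isometry from the range of G onto the range of F, and X = ‖X‖_S · F W G; and there exist (T, W', G') with T a positive semidefinite m×m matrix with ‖T‖₂ = ‖X‖_T, G' a positive semidefinite n×n matrix each diagonal entry of G'² being at most 1, W' an m×n partial isometry from the range of G' onto the range of T, and X = T W' G'. -/

import Mathlib

open Matrix
open scoped ComplexOrder

noncomputable section

namespace MatFact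

/-- ℓ² norm of a complex vector. -/
def vnorm {n : ℕ} (v : Fin n → ℂ) : ℝ := Real.sqrt (∑ j, ‖v j‖ ^ 2)

/-- Operator norm of a matrix as a map ℓ²(Fin n) → ℓ²(Fin m). -/
def opNorm {m n : ℕ} (X : Matrix (Fin m) (Fin n) ℂ) : ℝ :=
  sSup {c : ℝ | ∃ v : Fin n → ℂ, vnorm v ≤ 1 ∧ c = vnorm (X.mulVec v)}

/-- Column norm: the maximal ℓ² norm of a column. -/
def colNorm {m n : ℕ} (X : Matrix (Fin m) (Fin n) ℂ) : ℝ :=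
  ⨆ j : Fin n, vnorm (fun i => X i j)

/-- Hilbert–Schmidt (Frobenius) norm. -/
def frobNorm {m n : ℕ} (X : Matrix (Fin m) (Fin n) ℂ) : ℝ :=
  Real.sqrt (∑ i, ∑ j, ‖X i j‖ ^ 2)

/-- Schur norm: operator norm of Schur (entrywise) multiplication by `X`
on matrices with the operator norm. -/
def schurNorm {m n : ℕ} (X : Matrix (Fin m) (Fin n) ℂ) : ℝ :=
  sSup {c : ℝ | ∃ A : Matrix (Fin m) (Fin n) ℂ, opNorm A ≤ 1 ∧
    c = opNorm (Matrix.hadamard X A)}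

/-- The T-norm (bilinear Schur norm). -/
def Tnorm {m n : ℕ} (X : Matrix (Fin m) (Fin n) ℂ) : ℝ :=
  sSup {c : ℝ | ∃ (a : Fin m → ℂ) (B : Matrix (Fin m) (Fin n) ℂ),
    (∀ i, ‖a i‖ ≤ 1) ∧ opNorm B ≤ 1 ∧
    c = vnorm (fun j => ∑ i, a i * X i j * B i j)}

/-- The F-norm: operator norm of `X` from `ℂⁿ` with the sup norm to `ℂᵐ`
with the ℓ² norm. -/
def Fnorm {m n : ℕ} (X : Matrix (Fin m) (Fin n) ℂ) : ℝ :=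
  sSup {c : ℝ | ∃ v : Fin n → ℂ, (∀ j, ‖v j‖ ≤ 1) ∧ c = vnorm (X.mulVec v)}

/-- The bilinear form norm. -/
def Bnorm {m n : ℕ} (Y : Matrix (Fin m) (Fin n) ℂ) : ℝ :=
  sSup {c : ℝ | ∃ (a : Fin m → ℂ) (b : Fin n → ℂ), (∀ i, ‖a i‖ ≤ 1) ∧
    (∀ j, ‖b j‖ ≤ 1) ∧ c = ‖∑ i, ∑ j, Y i j * a i * b j‖}

/-- The completely bounded F-norm. -/
def cbF {m n : ℕ} (X : Matrix (Fin m) (Fin n) ℂ) : ℝ :=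
  sInf {c : ℝ | ∃ (A : Matrix (Fin m) (Fin n) ℂ) (ξ : Fin n → ℂ),
    X = A * Matrix.diagonal ξ ∧ c = opNorm A * vnorm ξ}

/-- The completely bounded bilinear form norm. -/
def cbB {m n : ℕ} (X : Matrix (Fin m) (Fin n) ℂ) : ℝ :=
  sInf {c : ℝ | ∃ (η : Fin m → ℂ) (B : Matrix (Fin m) (Fin n) ℂ) (ξ : Fin n → ℂ),
    X = Matrix.diagonal η * B * Matrix.diagonal ξ ∧
    c = vnorm η * opNorm B * vnorm ξ}

/-- The range (column space) of a matrix, as a submodule of `ℂᵐ`. -/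
def ran {m n : ℕ} (X : Matrix (Fin m) (Fin n) ℂ) : Submodule ℂ (Fin m → ℂ) :=
  LinearMap.range X.mulVecLin

/-- `P` is the orthogonal projection onto the subspace `E`, i.e. `P` is a
Hermitian idempotent with range `E`. -/
def IsOrthProjOnto {n : ℕ} (P : Matrix (Fin n) (Fin n) ℂ)
    (E : Submodule ℂ (Fin n → ℂ)) : Prop :=
  P.IsHermitian ∧ P * P = P ∧ ran P = E

/-- `W` is a partial isometry with support `E` and range `F`. -/
def IsPartialIsometryFromTo {m n : ℕ} (W : Matrix (Fin m) (Fin n) ℂ)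
    (E : Submodule ℂ (Fin n → ℂ)) (F : Submodule ℂ (Fin m → ℂ)) : Prop :=
  IsOrthProjOnto (Wᴴ * W) E ∧ IsOrthProjOnto (W * Wᴴ) F

/-- A cb operator factorization of `X`. -/
def IsCbOpFact {m n : ℕ} (X A : Matrix (Fin m) (Fin n) ℂ) (ξ : Fin n → ℂ) : Prop :=
  (∀ j, 0 ≤ ξ j) ∧ vnorm ξ = 1 ∧ opNorm A = cbF X ∧
  (∀ j, ξ j = 0 → ∀ i, A i j = 0) ∧ X = A * Matrix.diagonal ξ

/-- A cb bilinear form factorization of `X`. -/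
def IsCbBilFact {m n : ℕ} (X : Matrix (Fin m) (Fin n) ℂ) (η : Fin m → ℂ)
    (B : Matrix (Fin m) (Fin n) ℂ) (ξ : Fin n → ℂ) : Prop :=
  (∀ i, 0 ≤ η i) ∧ (∀ j, 0 ≤ ξ j) ∧ vnorm η = 1 ∧ vnorm ξ = 1 ∧
  opNorm B = cbB X ∧ (∀ j, ξ j = 0 → ∀ i, B i j = 0) ∧
  (∀ i, η i = 0 → ∀ j, B i j = 0) ∧ X = Matrix.diagonal η * B * Matrix.diagonal ξ

/-- A Schur factorization of `X`. -/
def IsSchurFact {m n : ℕ} (X : Matrix (Fin m) (Fin n) ℂ)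
    (F : Matrix (Fin m) (Fin m) ℂ) (W : Matrix (Fin m) (Fin n) ℂ)
    (G : Matrix (Fin n) (Fin n) ℂ) : Prop :=
  F.PosSemidef ∧ (∀ i, (F * F) i i ≤ 1) ∧ G.PosSemidef ∧ (∀ j, (G * G) j j ≤ 1) ∧
  IsPartialIsometryFromTo W (ran G) (ran F) ∧
  X = (schurNorm X : ℂ) • (F * W * G)

/-- A bilinear Schur factorization of `X`. -/
def IsBilinSchurFact {m n : ℕ} (X : Matrix (Fin m) (Fin n) ℂ)
    (T : Matrix (Fin m) (Fin m) ℂ) (W : Matrix (Fin m) (Fin n) ℂ)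
    (G : Matrix (Fin n) (Fin n) ℂ) : Prop :=
  T.PosSemidef ∧ frobNorm T = Tnorm X ∧ G.PosSemidef ∧ (∀ j, (G * G) j j ≤ 1) ∧
  IsPartialIsometryFromTo W (ran G) (ran T) ∧ X = T * W * G

/-- Maximal diagonal entry (real part) of a square matrix. -/
def maxDiag {n : ℕ} (P : Matrix (Fin n) (Fin n) ℂ) : ℝ := ⨆ i, (P i i).re

end MatFact

namespace MatFact

theorem exists_polar {m d : ℕ} (L : Matrix (Fin m) (Fin d) ℂ)
    (hL : Function.Injective L.mulVec) :
    ∃ (F : Matrix (Fin m) (Fin m) ℂ) (U : Matrix (Fin m) (Fin d) ℂ),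
      F.PosSemidef ∧ F * F = L * Lᴴ ∧ F * U = L ∧ Uᴴ * U = 1 ∧ ran U = ran F := by
  have hA := Matrix.PosDef.conjTranspose_mul_self L hL
  obtain ⟨S, hS, hSS⟩ : ∃ S : Matrix (Fin d) (Fin d) ℂ, S.PosSemidef ∧
      S * (Lᴴ * L) * S = 1 := by
    open scoped MatrixOrder in
    have h0 : 0 ≤ Lᴴ * L := hA.posSemidef.nonneg
    have hB : (CFC.sqrt (Lᴴ * L)).PosSemidef := (CFC.sqrt_nonneg _).posSemidef
    have hBB : CFC.sqrt (Lᴴ * L) * CFC.sqrt (Lᴴ * L) = Lᴴ * L := CFC.sqrt_mul_sqrt_self _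
    generalize CFC.sqrt (Lᴴ * L) = B at hB hBB
    have hdet : IsUnit B.det := by
      have := hA.det_pos.ne'
      rw [← hBB, det_mul] at this
      exact (left_ne_zero_of_mul this).isUnit
    refine ⟨B⁻¹, hB.inv, ?_⟩
    rw [← hBB, ← Matrix.mul_assoc, Matrix.nonsing_inv_mul _ hdet, Matrix.one_mul,
      Matrix.mul_nonsing_inv _ hdet]
  have hFU : L * S * Lᴴ * (L * S) = L := by
    calc L * S * Lᴴ * (L * S) = L * (S * (Lᴴ * L) * S) := by simp only [Matrix.mul_assoc]
      _ = L := by rw [hSS, Matrix.mul_one]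
  have hran {p q r : ℕ} (A : Matrix (Fin p) (Fin q) ℂ) (B : Matrix (Fin q) (Fin r) ℂ) :
      ran (A * B) ≤ ran A := by
    rintro _ ⟨x, rfl⟩
    exact ⟨B *ᵥ x, by simp [Matrix.mulVec_mulVec]⟩
  refine ⟨L * S * Lᴴ, L * S, hS.mul_mul_conjTranspose_same L, ?_, hFU, ?_, ?_⟩
  · calc L * S * Lᴴ * (L * S * Lᴴ) = (L * S * Lᴴ * (L * S)) * Lᴴ := by
          simp only [Matrix.mul_assoc]
      _ = _ := by rw [hFU]
  · rw [conjTranspose_mul, hS.1.eq, ← hSS]; simp only [Matrix.mul_assoc]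
  · refine le_antisymm ?_ (hran _ _)
    calc ran (L * S) = ran (L * S * Lᴴ * (L * S) * S) := by rw [hFU]
      _ ≤ ran (L * S * Lᴴ) := by
        rw [Matrix.mul_assoc]; exact hran _ _

theorem isOrthProjOnto_mul_conjTranspose {m d : ℕ} {U : Matrix (Fin m) (Fin d) ℂ}
    (hU : Uᴴ * U = 1) : IsOrthProjOnto (U * Uᴴ) (ran U) := by
  refine ⟨isHermitian_mul_conjTranspose_self U, ?_, ?_⟩
  · calc U * Uᴴ * (U * Uᴴ) = U * (Uᴴ * U) * Uᴴ := by simp only [Matrix.mul_assoc]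
      _ = _ := by rw [hU, Matrix.mul_one]
  · apply le_antisymm
    · rintro _ ⟨x, rfl⟩
      exact ⟨Uᴴ *ᵥ x, by simp [Matrix.mulVec_mulVec]⟩
    · rintro _ ⟨x, rfl⟩
      refine ⟨U *ᵥ x, ?_⟩
      simp only [mulVecLin_apply, mulVec_mulVec, Matrix.mul_assoc, hU, Matrix.mul_one]

theorem exists_spanning_coordinates {m n : ℕ} {H : Type*} [NormedAddCommGroup H]
    [InnerProductSpace ℂ H] [FiniteDimensional ℂ H] (u : Fin m → H) (v : Fin n → H) :
    ∃ (d : ℕ) (u' : Fin m → EuclideanSpace ℂ (Fin d)) (v' : Fin n → EuclideanSpace ℂ (Fin d)),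
      (∀ i j, inner ℂ (u' i) (v' j) = inner ℂ (u i) (v j)) ∧
      (∀ i, ‖u' i‖ ≤ ‖u i‖) ∧ (∀ j, ‖v' j‖ ≤ ‖v j‖) ∧
      (∀ x, (∀ i, inner ℂ (u' i) x = 0) → x = 0) ∧
      (∀ x, (∀ j, inner ℂ (v' j) x = 0) → x = 0) := by
  set S := Submodule.span ℂ (Set.range v) with hS
  have hv (j) : v j ∈ S := Submodule.subset_span ⟨j, rfl⟩
  set u₁ : Fin m → H := fun i => S.starProjection (u i) with hu₁
  set K := Submodule.span ℂ (Set.range u₁) with hK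
  have hu (i) : u₁ i ∈ K := Submodule.subset_span ⟨i, rfl⟩
  have hKS : K ≤ S := by
    rw [hK, Submodule.span_le]
    rintro _ ⟨i, rfl⟩
    exact Submodule.starProjection_apply_mem _ _
  have horth {T : Submodule ℂ H} {ι : Type} (w : ι → H)
      (hT : T = Submodule.span ℂ (Set.range w)) (y : H) (hy : y ∈ T)
      (h : ∀ i, inner ℂ (w i) y = 0) : y = 0 := by
    have : y ∈ Tᗮ := by
      rw [hT, Submodule.mem_orthogonal]
      intro z hz
      induction hz using Submodule.span_induction with
      | mem z hz => obtain ⟨i, rfl⟩ := hz; exact h i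
      | zero => simp
      | add a b _ _ ha hb => rw [inner_add_left, ha, hb, add_zero]
      | smul c a _ ha => rw [inner_smul_left, ha, mul_zero]
    exact inner_self_eq_zero.mp ((Submodule.mem_orthogonal _ _).mp this y hy)
  set e := (stdOrthonormalBasis ℂ K).repr with he
  refine ⟨Module.finrank ℂ K, fun i => e ⟨u₁ i, hu i⟩,
    fun j => e (K.orthogonalProjectionOnto (v j)), ?_, ?_, ?_, ?_, ?_⟩
  · intro i j
    rw [LinearIsometryEquiv.inner_map_map, Submodule.inner_orthogonalProjectionOnto_eq_of_mem_left]
    change inner ℂ (S.starProjection (u i)) (v j) = _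
    rw [Submodule.inner_starProjection_left_eq_right,
      Submodule.starProjection_eq_self_iff.mpr (hv j)]
  · intro i
    rw [LinearIsometryEquiv.norm_map]
    exact Submodule.norm_starProjection_apply_le _ _
  · intro j
    rw [LinearIsometryEquiv.norm_map]
    exact Submodule.norm_orthogonalProjectionOnto_apply_le _ _
  · intro x hx
    obtain ⟨y, rfl⟩ := e.surjective x
    simp only [LinearIsometryEquiv.inner_map_map] at hx
    have : (y : H) = 0 := horth u₁ hK y y.2 hx
    rw [Submodule.coe_eq_zero] at this
    rw [this, map_zero]
  · intro x hx
    obtain ⟨y, rfl⟩ := e.surjective x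
    simp only [LinearIsometryEquiv.inner_map_map] at hx
    have : (y : H) = 0 := by
      refine horth v hS y (hKS y.2) fun j => ?_
      rw [← inner_conj_symm, ← Submodule.inner_orthogonalProjectionOnto_eq_of_mem_left,
        inner_conj_symm]
      exact hx j
    rw [Submodule.coe_eq_zero] at this
    rw [this, map_zero]

theorem exists_factorization_of_inner {m n : ℕ} {H : Type*} [NormedAddCommGroup H]
    [InnerProductSpace ℂ H] [FiniteDimensional ℂ H] (u : Fin m → H) (v : Fin n → H)
    {X : Matrix (Fin m) (Fin n) ℂ} (hX : ∀ i j, inner ℂ (u i) (v j) = X i j) :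
    ∃ (F : Matrix (Fin m) (Fin m) ℂ) (W : Matrix (Fin m) (Fin n) ℂ)
      (G : Matrix (Fin n) (Fin n) ℂ) (d : ℕ) (L : Matrix (Fin m) (Fin d) ℂ)
      (R : Matrix (Fin d) (Fin n) ℂ),
      F.PosSemidef ∧ G.PosSemidef ∧ IsPartialIsometryFromTo W (ran G) (ran F) ∧
      X = F * W * G ∧ X = L * R ∧ F * F = L * Lᴴ ∧ G * G = Rᴴ * R ∧
      (∀ i, (L * Lᴴ) i i ≤ ((‖u i‖ ^ 2 : ℝ) : ℂ)) ∧
      (∀ j, (Rᴴ * R) j j ≤ ((‖v j‖ ^ 2 : ℝ) : ℂ)) := by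
  obtain ⟨d, u', v', huv, hu, hv, hu0, hv0⟩ := exists_spanning_coordinates u v
  have key {p : ℕ} (w : Fin p → EuclideanSpace ℂ (Fin d))
      (hw : ∀ x, (∀ i, inner ℂ (w i) x = 0) → x = 0) :
      Function.Injective (Matrix.of fun i k => star (w i k)).mulVec := by
    rw [← Matrix.coe_mulVecLin, ← LinearMap.ker_eq_bot, LinearMap.ker_eq_bot']
    intro x hx
    have := hw (WithLp.toLp 2 x) fun i => by
      have := congrFun hx i
      simpa [PiLp.inner_apply, Matrix.mulVec, dotProduct, mul_comm] using this
    simpa using this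
  have diag {p : ℕ} (w : Fin p → EuclideanSpace ℂ (Fin d)) (i) :
      ∑ k, star (w i k) * w i k = ((‖w i‖ ^ 2 : ℝ) : ℂ) := by
    rw [EuclideanSpace.norm_sq_eq]
    push_cast
    exact Finset.sum_congr rfl fun k _ => RCLike.conj_mul _
  obtain ⟨F, U, hF, hFF, hFU, hU, hUF⟩ := exists_polar _ (key u' hu0)
  obtain ⟨G, V, hG, hGG, hGV, hV, hVG⟩ := exists_polar _ (key v' hv0)
  set L : Matrix (Fin m) (Fin d) ℂ := Matrix.of fun i k => star (u' i k) with hL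
  set R : Matrix (Fin n) (Fin d) ℂ := Matrix.of fun i k => star (v' i k) with hR
  have hXLR : X = L * Rᴴ := by
    ext i j
    rw [← hX, ← huv]
    simp [hL, hR, Matrix.mul_apply, PiLp.inner_apply, mul_comm]
  refine ⟨F, U * Vᴴ, G, d, L, Rᴴ, hF, hG, ⟨?_, ?_⟩, ?_, hXLR, hFF, by simpa using hGG, ?_, ?_⟩
  · have : (U * Vᴴ)ᴴ * (U * Vᴴ) = V * Vᴴ := by
      calc (U * Vᴴ)ᴴ * (U * Vᴴ) = V * (Uᴴ * U) * Vᴴ := by simp [Matrix.mul_assoc]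
        _ = _ := by rw [hU, Matrix.mul_one]
    rw [this, ← hVG]
    exact isOrthProjOnto_mul_conjTranspose hV
  · have : (U * Vᴴ) * (U * Vᴴ)ᴴ = U * Uᴴ := by
      calc (U * Vᴴ) * (U * Vᴴ)ᴴ = U * (Vᴴ * V) * Uᴴ := by simp [Matrix.mul_assoc]
        _ = _ := by rw [hV, Matrix.mul_one]
    rw [this, ← hUF]
    exact isOrthProjOnto_mul_conjTranspose hU
  · rw [hXLR, ← hFU, ← hGV, conjTranspose_mul, hG.1.eq]
    simp only [Matrix.mul_assoc]
  · intro i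
    have : (L * Lᴴ) i i = ∑ k, star (u' i k) * u' i k := by
      simp [hL, Matrix.mul_apply]
    rw [this, diag, Complex.real_le_real]
    exact pow_le_pow_left₀ (norm_nonneg _) (hu i) 2
  · intro j
    have : (Rᴴᴴ * Rᴴ) j j = ∑ k, star (v' j k) * v' j k := by
      simp [hR, Matrix.mul_apply]
    rw [this, diag, Complex.real_le_real]
    exact pow_le_pow_left₀ (norm_nonneg _) (hv j) 2

theorem exists_repr_of_real_linear {m n : ℕ} {ι : Type*} [Fintype ι] [DecidableEq ι]
    (f : ((ι → ℝ) × (Fin m → Fin n → ℂ)) →ₗ[ℝ] ℝ) :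
    ∃ (c : ι → ℝ) (Y : Fin m → Fin n → ℂ), ∀ p,
      f p = (∑ i, ∑ j, Y i j * p.2 i j).re - ∑ k, c k * p.1 k := by
  let s (i : Fin m) (j : Fin n) (w : ℂ) : Fin m → Fin n → ℂ := Pi.single i (Pi.single j w)
  refine ⟨fun k => -f (Pi.single k 1, 0),
    fun i j => f (0, s i j 1) - Complex.I * f (0, s i j Complex.I), fun p => ?_⟩
  have hp : p = ∑ k, p.1 k • ((Pi.single k 1 : ι → ℝ), (0 : Fin m → Fin n → ℂ)) +
      ∑ i, ∑ j, ((p.2 i j).re • ((0 : ι → ℝ), s i j 1) +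
        (p.2 i j).im • ((0 : ι → ℝ), s i j Complex.I)) := by
    refine Prod.ext ?_ ?_
    · ext k
      simp [Prod.fst_sum, Finset.sum_apply, Pi.single_apply]
    · ext i j
      simp only [Prod.snd_add, Prod.snd_sum, Prod.smul_snd, smul_zero, Finset.sum_const_zero,
        Finset.sum_apply, Pi.add_apply, Pi.smul_apply, s]
      rw [Finset.sum_eq_single i (fun b _ hb => by simp [hb.symm]) (by simp),
        Finset.sum_eq_single j (fun b _ hb => by simp [hb.symm]) (by simp)]
      simp
  conv_lhs => rw [hp]
  simp only [map_add, map_sum, map_smul, smul_eq_mul, Complex.re_sum]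
  rw [add_comm, sub_eq_add_neg, ← Finset.sum_neg_distrib]
  refine congrArg₂ _ (Finset.sum_congr rfl fun i _ => Finset.sum_congr rfl fun j _ => ?_)
    (Finset.sum_congr rfl fun k _ => by ring)
  simp
  ring

/-- Pairs `(r, Z)` such that `Z` is the off-diagonal block of a positive semidefinite block
matrix whose diagonal entries, summed over each fibre of `g`, are bounded by `r`. -/
def blockCone {m n : ℕ} {ι : Type*} [DecidableEq ι] (g : Fin m ⊕ Fin n → ι) :
    Set ((ι → ℝ) × (Fin m → Fin n → ℂ)) :=
  {p | ∃ M : Matrix (Fin m ⊕ Fin n) (Fin m ⊕ Fin n) ℂ, M.PosSemidef ∧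
    (∀ i j, M (.inl i) (.inr j) = p.2 i j) ∧
    ∀ k, ∑ x, (if g x = k then (M x x).re else 0) ≤ p.1 k}

theorem add_mem_blockCone {m n : ℕ} {ι : Type*} [DecidableEq ι] {g : Fin m ⊕ Fin n → ι}
    {p q : (ι → ℝ) × (Fin m → Fin n → ℂ)} (hp : p ∈ blockCone g) (hq : q ∈ blockCone g) :
    p + q ∈ blockCone g := by
  obtain ⟨M, hM, hMp, hMk⟩ := hp
  obtain ⟨N, hN, hNq, hNk⟩ := hq
  refine ⟨M + N, hM.add hN, fun i j => by simp [hMp, hNq], fun k => ?_⟩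
  refine le_trans (le_of_eq ?_) (add_le_add (hMk k) (hNk k))
  rw [← Finset.sum_add_distrib]
  refine Finset.sum_congr rfl fun x _ => ?_
  split_ifs <;> simp

theorem smul_mem_blockCone {m n : ℕ} {ι : Type*} [DecidableEq ι] {g : Fin m ⊕ Fin n → ι}
    {p : (ι → ℝ) × (Fin m → Fin n → ℂ)} (hp : p ∈ blockCone g) {a : ℝ} (ha : 0 ≤ a) :
    a • p ∈ blockCone g := by
  obtain ⟨M, hM, hMp, hMk⟩ := hp
  refine ⟨(a : ℂ) • M, hM.smul (by exact_mod_cast ha), fun i j => by simp [hMp], fun k => ?_⟩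
  refine le_trans (le_of_eq ?_) (mul_le_mul_of_nonneg_left (hMk k) ha)
  rw [Finset.mul_sum]
  refine Finset.sum_congr rfl fun x _ => ?_
  split_ifs <;> simp

theorem exists_eq_conjTranspose_mul_self {N : Type*} [Fintype N] [DecidableEq N]
    {M : Matrix N N ℂ} (hM : M.PosSemidef) : ∃ A : Matrix N N ℂ, M = Aᴴ * A := by
  open scoped MatrixOrder in
  exact CStarAlgebra.nonneg_iff_eq_star_mul_self.mp hM.nonneg

theorem conjTranspose_mul_self_diag_re {N K : Type*} [Fintype N] (A : Matrix N K ℂ) (x : K) :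
    ((Aᴴ * A) x x).re = ∑ y, ‖A y x‖ ^ 2 := by
  simp [Matrix.mul_apply, Complex.re_sum, ← Complex.normSq_apply, Complex.normSq_eq_norm_sq]

theorem mul_conjTranspose_self_diag_re {N K : Type*} [Fintype K] (A : Matrix N K ℂ) (x : N) :
    ((A * Aᴴ) x x).re = ∑ y, ‖A x y‖ ^ 2 := by
  simpa using conjTranspose_mul_self_diag_re Aᴴ x

theorem isClosed_blockCone {m n : ℕ} {ι : Type*} [Fintype ι] [DecidableEq ι]
    (g : Fin m ⊕ Fin n → ι) : IsClosed (blockCone g) := by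
  refine IsSeqClosed.isClosed fun p q hp hpq => ?_
  choose M hM hMp hMk using hp
  choose A hA using fun t => exists_eq_conjTranspose_mul_self (hM t)
  obtain ⟨C, hC⟩ := hpq.norm.bddAbove_range
  have hC' (t) : ‖p t‖ ≤ C := hC ⟨t, rfl⟩
  have hAbd (t y x) : ‖A t y x‖ ^ 2 ≤ C := by
    have hd (x) : 0 ≤ ((M t) x x).re := by
      rw [hA, conjTranspose_mul_self_diag_re]; positivity
    calc ‖A t y x‖ ^ 2 ≤ ∑ y, ‖A t y x‖ ^ 2 :=
          Finset.single_le_sum (f := fun y => ‖A t y x‖ ^ 2) (fun _ _ => by positivity)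
            (Finset.mem_univ y)
      _ = if g x = g x then (M t x x).re else 0 := by
          rw [if_pos rfl, hA, conjTranspose_mul_self_diag_re]
      _ ≤ ∑ x', (if g x' = g x then (M t x' x').re else 0) :=
          Finset.single_le_sum (f := fun x' => if g x' = g x then (M t x' x').re else 0)
            (fun x' _ => by split_ifs <;> simp [hd]) (Finset.mem_univ x)
      _ ≤ (p t).1 (g x) := hMk t _
      _ ≤ ‖(p t).1 (g x)‖ := le_abs_self _
      _ ≤ ‖p t‖ := (norm_le_pi_norm _ _).trans (norm_fst_le _)
      _ ≤ C := hC' t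
  let a : ℕ → (Fin m ⊕ Fin n → Fin m ⊕ Fin n → ℂ) := fun t => A t
  have hmem (t) : a t ∈ Metric.closedBall (0 : Fin m ⊕ Fin n → Fin m ⊕ Fin n → ℂ) (√C) := by
    rw [mem_closedBall_zero_iff, pi_norm_le_iff_of_nonneg (Real.sqrt_nonneg _)]
    intro y
    rw [pi_norm_le_iff_of_nonneg (Real.sqrt_nonneg _)]
    exact fun x => Real.le_sqrt_of_sq_le (hAbd t y x)
  obtain ⟨b, -, φ, hφ, hb⟩ := tendsto_subseq_of_bounded Metric.isBounded_closedBall hmem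
  have hent (x y) : Filter.Tendsto (fun t => M (φ t) x y) Filter.atTop
      (nhds (((Matrix.of b)ᴴ * Matrix.of b) x y)) := by
    have hcont : Continuous fun e : Fin m ⊕ Fin n → Fin m ⊕ Fin n → ℂ =>
        ((Matrix.of e)ᴴ * Matrix.of e) x y := by
      simp only [Matrix.mul_apply, Matrix.conjTranspose_apply, Matrix.of_apply]
      fun_prop
    refine ((hcont.tendsto b).comp hb).congr fun t => ?_
    rw [hA]
    rfl
  have hq := hpq.comp hφ.tendsto_atTop
  refine ⟨(Matrix.of b)ᴴ * Matrix.of b, posSemidef_conjTranspose_mul_self _, fun i j => ?_,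
    fun k => ?_⟩
  · refine tendsto_nhds_unique (hent _ _) ?_
    simp only [hMp]
    exact (((continuous_apply j).comp ((continuous_apply i).comp continuous_snd)).tendsto q).comp hq
  · refine le_of_tendsto_of_tendsto' (tendsto_finsetSum _ fun x _ => ?_)
      (((continuous_apply k).comp continuous_fst).tendsto q |>.comp hq) fun t => hMk (φ t) k
    split_ifs
    · exact (Complex.continuous_re.tendsto _).comp (hent x x)
    · exact tendsto_const_nhds

theorem exists_dual_of_notMem_blockCone {m n : ℕ} {ι : Type*} [Fintype ι] [DecidableEq ι]
    {g : Fin m ⊕ Fin n → ι} {p : (ι → ℝ) × (Fin m → Fin n → ℂ)} (hp : p ∉ blockCone g) :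
    ∃ (c : ι → ℝ) (Y : Fin m → Fin n → ℂ), (∀ k, 0 < c k) ∧
      (∀ q ∈ blockCone g, (∑ i, ∑ j, Y i j * q.2 i j).re ≤ ∑ k, c k * q.1 k) ∧
      ∑ k, c k * p.1 k < (∑ i, ∑ j, Y i j * p.2 i j).re := by
  have hconv : Convex ℝ (blockCone g) := fun x hx y hy a b ha hb _ =>
    add_mem_blockCone (smul_mem_blockCone hx ha) (smul_mem_blockCone hy hb)
  obtain ⟨f, u, hf, hfp⟩ := geometric_hahn_banach_closed_point hconv (isClosed_blockCone g) hp
  have h0 : (0 : (ι → ℝ) × (Fin m → Fin n → ℂ)) ∈ blockCone g :=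
    ⟨0, PosSemidef.zero, by simp, by simp⟩
  have hu : 0 < u := by simpa using hf 0 h0
  have hle : ∀ q ∈ blockCone g, f q ≤ 0 := fun q hq => by
    by_contra! hpos
    have := hf _ (smul_mem_blockCone hq (div_nonneg hu.le hpos.le))
    rw [map_smul, smul_eq_mul, div_mul_cancel₀ _ hpos.ne'] at this
    exact this.false
  obtain ⟨c, Y, hcY⟩ := exists_repr_of_real_linear f.toLinearMap
  simp only [ContinuousLinearMap.coe_coe] at hcY
  have hc (k) : 0 ≤ c k := by
    have := hle (Pi.single k 1, 0) ⟨0, PosSemidef.zero, by simp, fun l => by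
      simp only [Matrix.zero_apply, Complex.zero_re, ite_self, Finset.sum_const_zero]
      exact (Pi.single_nonneg.mpr zero_le_one : (0 : ι → ℝ) ≤ Pi.single k 1) l⟩
    rw [hcY] at this
    simpa [Pi.single_apply] using this
  have hgap : ∑ k, c k * p.1 k < (∑ i, ∑ j, Y i j * p.2 i j).re := by
    have := hcY p
    linarith
  set D := (∑ i, ∑ j, Y i j * p.2 i j).re - ∑ k, c k * p.1 k with hD
  have hDpos : 0 < D := sub_pos.mpr hgap
  set δ := D / (2 * (|∑ k, p.1 k| + 1)) with hδ
  have hδpos : 0 < δ := by positivity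
  refine ⟨fun k => c k + δ, Y, fun k => by linarith [hc k], fun q hq => ?_, ?_⟩
  · have hq0 (k) : 0 ≤ q.1 k := by
      obtain ⟨M, hM, -, hMk⟩ := hq
      refine le_trans (Finset.sum_nonneg fun x _ => ?_) (hMk k)
      split_ifs
      · exact (Complex.nonneg_iff.mp hM.diag_nonneg).1
      · exact le_rfl
    have := hle q hq
    rw [hcY] at this
    refine le_trans (sub_nonpos.mp this) (Finset.sum_le_sum fun k _ => ?_)
    exact mul_le_mul_of_nonneg_right (by linarith) (hq0 k)
  · have h1 : ∑ k, (c k + δ) * p.1 k = ∑ k, c k * p.1 k + δ * ∑ k, p.1 k := by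
      rw [Finset.mul_sum, ← Finset.sum_add_distrib]
      exact Finset.sum_congr rfl fun k _ => by ring
    have h2 : δ * ∑ k, p.1 k < D := by
      have h3 : δ * (2 * (|∑ k, p.1 k| + 1)) = D := div_mul_cancel₀ _ (by positivity)
      have h4 := mul_le_mul_of_nonneg_left (le_abs_self (∑ k, p.1 k)) hδpos.le
      have h5 : 0 ≤ δ * |∑ k, p.1 k| := by positivity
      nlinarith
    rw [h1]
    linarith

theorem vnorm_nonneg {n : ℕ} (v : Fin n → ℂ) : 0 ≤ vnorm v := Real.sqrt_nonneg _

theorem vnorm_sq {n : ℕ} (v : Fin n → ℂ) : vnorm v ^ 2 = ∑ j, ‖v j‖ ^ 2 :=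
  Real.sq_sqrt (by positivity)

theorem vnorm_eq_norm {n : ℕ} (v : Fin n → ℂ) : vnorm v = ‖WithLp.toLp 2 v‖ := by
  rw [EuclideanSpace.norm_eq]; rfl

theorem vnorm_smul {n : ℕ} (c : ℂ) (v : Fin n → ℂ) : vnorm (c • v) = ‖c‖ * vnorm v := by
  rw [vnorm_eq_norm, vnorm_eq_norm, WithLp.toLp_smul, norm_smul]

theorem norm_sum_mul_le {n : ℕ} (v w : Fin n → ℂ) : ‖∑ j, v j * w j‖ ≤ vnorm v * vnorm w := by
  have := norm_inner_le_norm (𝕜 := ℂ) (WithLp.toLp 2 (star v)) (WithLp.toLp 2 w)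
  rw [← vnorm_eq_norm, ← vnorm_eq_norm] at this
  simpa [PiLp.inner_apply, vnorm, mul_comm] using this

theorem frobNorm_sq {m n : ℕ} (X : Matrix (Fin m) (Fin n) ℂ) :
    frobNorm X ^ 2 = ∑ i, ∑ j, ‖X i j‖ ^ 2 :=
  Real.sq_sqrt (by positivity)

theorem frobNorm_nonneg {m n : ℕ} (X : Matrix (Fin m) (Fin n) ℂ) : 0 ≤ frobNorm X :=
  Real.sqrt_nonneg _

theorem vnorm_mulVec_le_frobNorm {m n : ℕ} (X : Matrix (Fin m) (Fin n) ℂ) (v : Fin n → ℂ) :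
    vnorm (X *ᵥ v) ≤ frobNorm X * vnorm v := by
  refine (sq_le_sq₀ (vnorm_nonneg _) (mul_nonneg (frobNorm_nonneg _) (vnorm_nonneg _))).mp ?_
  rw [mul_pow, vnorm_sq, frobNorm_sq, Finset.sum_mul]
  refine Finset.sum_le_sum fun i _ => ?_
  rw [← vnorm_sq (X i), ← mul_pow]
  exact pow_le_pow_left₀ (norm_nonneg _) (norm_sum_mul_le (X i) v) 2

theorem bddAbove_opNorm {m n : ℕ} (X : Matrix (Fin m) (Fin n) ℂ) :
    BddAbove {c : ℝ | ∃ v : Fin n → ℂ, vnorm v ≤ 1 ∧ c = vnorm (X.mulVec v)} := by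
  refine ⟨frobNorm X, ?_⟩
  rintro _ ⟨v, hv, rfl⟩
  exact (vnorm_mulVec_le_frobNorm X v).trans
    (mul_le_of_le_one_right (frobNorm_nonneg X) hv)

theorem opNorm_le {m n : ℕ} {X : Matrix (Fin m) (Fin n) ℂ} {C : ℝ}
    (h : ∀ v, vnorm v ≤ 1 → vnorm (X *ᵥ v) ≤ C) : opNorm X ≤ C := by
  refine csSup_le ⟨_, 0, by simp [vnorm], rfl⟩ ?_
  rintro _ ⟨v, hv, rfl⟩
  exact h v hv

theorem opNorm_nonneg {m n : ℕ} (X : Matrix (Fin m) (Fin n) ℂ) : 0 ≤ opNorm X :=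
  (vnorm_nonneg _).trans (le_csSup (bddAbove_opNorm X) ⟨0, by simp [vnorm], rfl⟩)

theorem opNorm_le_frobNorm {m n : ℕ} (X : Matrix (Fin m) (Fin n) ℂ) : opNorm X ≤ frobNorm X :=
  opNorm_le fun v hv => (vnorm_mulVec_le_frobNorm X v).trans
    (mul_le_of_le_one_right (frobNorm_nonneg X) hv)

theorem vnorm_mulVec_le {m n : ℕ} (X : Matrix (Fin m) (Fin n) ℂ) (v : Fin n → ℂ) :
    vnorm (X *ᵥ v) ≤ opNorm X * vnorm v := by
  rcases (vnorm_nonneg v).eq_or_lt with h | h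
  · have := vnorm_mulVec_le_frobNorm X v
    rwa [← h, mul_zero] at this ⊢
  · have hn : ‖((vnorm v)⁻¹ : ℂ)‖ = (vnorm v)⁻¹ := by
      rw [norm_inv, Complex.norm_real, Real.norm_of_nonneg h.le]
    have := le_csSup (bddAbove_opNorm X)
      ⟨((vnorm v)⁻¹ : ℂ) • v, by rw [vnorm_smul, hn, inv_mul_cancel₀ h.ne'], rfl⟩
    rw [Matrix.mulVec_smul, vnorm_smul, hn, inv_mul_le_iff₀ h] at this
    rwa [mul_comm]

theorem norm_apply_le_opNorm {m n : ℕ} (X : Matrix (Fin m) (Fin n) ℂ) (i : Fin m) (j : Fin n) :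
    ‖X i j‖ ≤ opNorm X := by
  have h1 := vnorm_mulVec_le X (Pi.single j 1)
  have h2 : vnorm (Pi.single j 1 : Fin n → ℂ) = 1 := by
    simp [vnorm, Pi.single_apply, apply_ite]
  rw [h2, mul_one, Matrix.mulVec_single_one] at h1
  refine le_trans ?_ h1
  rw [vnorm_eq_norm]
  exact PiLp.norm_apply_le (WithLp.toLp 2 (X.col j)) i

theorem vnorm_transpose_mulVec_le {m n : ℕ} {B : Matrix (Fin m) (Fin n) ℂ} (hB : opNorm B ≤ 1)
    (a : Fin m → ℂ) : vnorm (Bᵀ *ᵥ a) ≤ vnorm a := by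
  set w := Bᵀ *ᵥ a with hw
  have hstar : vnorm (star w) = vnorm w := by simp [vnorm]
  have h1 : ∑ j, w j * star w j = ∑ i, a i * (B *ᵥ star w) i := by
    simp only [hw, Matrix.mulVec, dotProduct, Finset.sum_mul, Finset.mul_sum,
      Matrix.transpose_apply]
    rw [Finset.sum_comm]
    exact Finset.sum_congr rfl fun _ _ => Finset.sum_congr rfl fun _ _ => by ring
  have h2 : ‖∑ j, w j * star w j‖ = vnorm w ^ 2 := by
    have : ∑ j, w j * star w j = ((∑ j, ‖w j‖ ^ 2 : ℝ) : ℂ) := by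
      push_cast
      exact Finset.sum_congr rfl fun j _ => Complex.mul_conj' _
    rw [this, vnorm_sq, Complex.norm_real, Real.norm_of_nonneg (by positivity)]
  have h3 : vnorm w ^ 2 ≤ vnorm a * vnorm w := by
    rw [← h2, h1]
    refine (norm_sum_mul_le _ _).trans (mul_le_mul_of_nonneg_left ?_ (vnorm_nonneg _))
    refine (vnorm_mulVec_le B _).trans ?_
    rw [hstar]
    exact mul_le_of_le_one_left (vnorm_nonneg _) hB
  rcases (vnorm_nonneg w).eq_or_lt with h | h
  · rw [← h]; exact vnorm_nonneg _
  · nlinarith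

theorem schurNorm_bound {m n : ℕ} (X : Matrix (Fin m) (Fin n) ℂ)
    {B : Matrix (Fin m) (Fin n) ℂ} (hB : opNorm B ≤ 1) :
    opNorm (Matrix.hadamard X B) ≤ schurNorm X := by
  refine le_csSup ⟨frobNorm X, ?_⟩ ⟨B, hB, rfl⟩
  rintro _ ⟨A, hA, rfl⟩
  refine (opNorm_le_frobNorm _).trans (Real.sqrt_le_sqrt ?_)
  refine Finset.sum_le_sum fun i _ => Finset.sum_le_sum fun j _ => ?_
  refine pow_le_pow_left₀ (norm_nonneg _) ?_ 2
  rw [Matrix.hadamard_apply, norm_mul]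
  exact mul_le_of_le_one_right (norm_nonneg _) ((norm_apply_le_opNorm A i j).trans hA)

theorem vnorm_bilinear_le_frobNorm {m n d : ℕ} {L : Matrix (Fin m) (Fin d) ℂ}
    {R : Matrix (Fin d) (Fin n) ℂ} (hR : ∀ j, (Rᴴ * R) j j ≤ 1) {a : Fin m → ℂ}
    (ha : ∀ i, ‖a i‖ ≤ 1) {B : Matrix (Fin m) (Fin n) ℂ} (hB : opNorm B ≤ 1) :
    vnorm (fun j => ∑ i, a i * (L * R) i j * B i j) ≤ frobNorm L := by
  have hR' (j) : vnorm (fun k => R k j) ≤ 1 := by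
    rw [← sq_le_one_iff₀ (vnorm_nonneg _), vnorm_sq, ← conjTranspose_mul_self_diag_re]
    exact (Complex.le_def.mp (hR j)).1
  have hcol (j) : ∑ i, a i * (L * R) i j * B i j =
      ∑ k, R k j * (Bᵀ *ᵥ fun i => a i * L i k) j := by
    simp only [Matrix.mul_apply, Matrix.mulVec, dotProduct, Finset.mul_sum, Finset.sum_mul,
      Matrix.transpose_apply]
    rw [Finset.sum_comm]
    exact Finset.sum_congr rfl fun _ _ => Finset.sum_congr rfl fun _ _ => by ring
  refine (sq_le_sq₀ (vnorm_nonneg _) (frobNorm_nonneg _)).mp ?_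
  rw [vnorm_sq, frobNorm_sq]
  calc ∑ j, ‖∑ i, a i * (L * R) i j * B i j‖ ^ 2
      ≤ ∑ j, ∑ k, ‖(Bᵀ *ᵥ fun i => a i * L i k) j‖ ^ 2 := by
        refine Finset.sum_le_sum fun j _ => ?_
        rw [hcol, ← vnorm_sq fun k => (Bᵀ *ᵥ fun i => a i * L i k) j]
        refine pow_le_pow_left₀ (norm_nonneg _) ((norm_sum_mul_le _ _).trans ?_) 2
        exact mul_le_of_le_one_left (vnorm_nonneg _) (hR' j)
    _ = ∑ k, vnorm (Bᵀ *ᵥ fun i => a i * L i k) ^ 2 := by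
        rw [Finset.sum_comm]
        simp only [vnorm_sq]
    _ ≤ ∑ k, vnorm (fun i => a i * L i k) ^ 2 := by
        refine Finset.sum_le_sum fun k _ => ?_
        exact pow_le_pow_left₀ (vnorm_nonneg _) (vnorm_transpose_mulVec_le hB _) 2
    _ ≤ ∑ k, ∑ i, ‖L i k‖ ^ 2 := by
        refine Finset.sum_le_sum fun k _ => ?_
        rw [vnorm_sq]
        refine Finset.sum_le_sum fun i _ => pow_le_pow_left₀ (norm_nonneg _) ?_ 2
        rw [norm_mul]
        exact mul_le_of_le_one_left (norm_nonneg _) (ha i)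
    _ = _ := Finset.sum_comm

theorem Tnorm_le_frobNorm {m n d : ℕ} {X : Matrix (Fin m) (Fin n) ℂ}
    {L : Matrix (Fin m) (Fin d) ℂ} {R : Matrix (Fin d) (Fin n) ℂ} (hX : X = L * R)
    (hR : ∀ j, (Rᴴ * R) j j ≤ 1) : Tnorm X ≤ frobNorm L := by
  refine csSup_le ⟨_, 0, 0, by simp, ?_, rfl⟩ ?_
  · exact (opNorm_le_frobNorm _).trans (by simp [frobNorm])
  · rintro _ ⟨a, B, ha, hB, rfl⟩
    rw [hX]
    exact vnorm_bilinear_le_frobNorm hR ha hB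

theorem Tnorm_bound {m n : ℕ} (X : Matrix (Fin m) (Fin n) ℂ)
    {B : Matrix (Fin m) (Fin n) ℂ} (hB : opNorm B ≤ 1) :
    vnorm (fun j => ∑ i, X i j * B i j) ≤ Tnorm X := by
  refine le_csSup ⟨frobNorm X, ?_⟩ ⟨1, B, by simp, hB, by simp⟩
  rintro _ ⟨a, B, ha, hB, rfl⟩
  have := vnorm_bilinear_le_frobNorm (L := X) (R := 1) (by simp) ha hB
  rwa [Matrix.mul_one] at this

theorem rankOne_le_of_blockCone_le {m n : ℕ} {ι : Type*} [Fintype ι] [DecidableEq ι]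
    {g : Fin m ⊕ Fin n → ι} {c : ι → ℝ} {Y : Fin m → Fin n → ℂ}
    (h : ∀ q ∈ blockCone g, (∑ i, ∑ j, Y i j * q.2 i j).re ≤ ∑ k, c k * q.1 k)
    (a : Fin m → ℂ) (b : Fin n → ℂ) :
    (∑ i, ∑ j, Y i j * (a i * b j)).re ≤
      ∑ i, c (g (.inl i)) * ‖a i‖ ^ 2 + ∑ j, c (g (.inr j)) * ‖b j‖ ^ 2 := by
  let w : Fin m ⊕ Fin n → ℂ := Sum.elim (star a) b
  refine (h (fun k => ∑ x, if g x = k then ‖w x‖ ^ 2 else 0, fun i j => a i * b j)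
    ⟨vecMulVec (star w) w, posSemidef_vecMulVec_star_self w, ?_, fun k => ?_⟩).trans
    (le_of_eq ?_)
  · intro i j
    simp [vecMulVec_apply, w]
  · refine le_of_eq (Finset.sum_congr rfl fun x _ => ?_)
    have : star w x * w x = ((‖w x‖ ^ 2 : ℝ) : ℂ) := by
      push_cast; exact Complex.conj_mul' _
    rw [vecMulVec_apply, this, Complex.ofReal_re]
  · simp only [Finset.mul_sum]
    rw [Finset.sum_comm]
    simp [w]

/-- If the bilinear dual functionals satisfy the required bound, then `X` is the off-diagonal
block of a positive semidefinite matrix with prescribed bounds on its diagonal. -/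
theorem mem_blockCone_of_bilinear_le {m n : ℕ} {ι : Type*} [Fintype ι] [DecidableEq ι]
    {g : Fin m ⊕ Fin n → ι} {X : Matrix (Fin m) (Fin n) ℂ} {r : ι → ℝ}
    (h : ∀ (B : Matrix (Fin m) (Fin n) ℂ) (e : ι → ℝ), (∀ k, 0 < e k) → opNorm B ≤ 1 →
      2 * (∑ i, ∑ j, X i j * B i j * ((e (g (.inl i)) : ℂ) * e (g (.inr j)))).re ≤
        ∑ k, e k ^ 2 * r k) :
    (r, fun i j => X i j) ∈ blockCone g := by
  by_contra hX
  obtain ⟨c, Y, hc, hY, hXY⟩ := exists_dual_of_notMem_blockCone hX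
  set e : ι → ℝ := fun k => √(c k) with he
  have he0 (k) : 0 < e k := Real.sqrt_pos.mpr (hc k)
  have he0' (k) : (e k : ℂ) ≠ 0 := by exact_mod_cast (he0 k).ne'
  have hsq (k) : e k ^ 2 = c k := Real.sq_sqrt (hc k).le
  set B : Matrix (Fin m) (Fin n) ℂ :=
    Matrix.of fun i j => Y i j / (2 * (e (g (.inl i)) * e (g (.inr j)))) with hB
  have hBn : opNorm B ≤ 1 := by
    refine opNorm_le fun v hv => ?_
    set w := B *ᵥ v with hw
    have hscale (k) (z : ℂ) : c k * ‖z / e k‖ ^ 2 = ‖z‖ ^ 2 := by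
      rw [norm_div, Complex.norm_real, Real.norm_of_nonneg (he0 k).le, div_pow, hsq,
        mul_div_cancel₀ _ (hc k).ne']
    have h1 := rankOne_le_of_blockCone_le hY (fun i => star (w i) / e (g (.inl i)))
      (fun j => v j / e (g (.inr j)))
    simp only [hscale, norm_star] at h1
    rw [← vnorm_sq, ← vnorm_sq] at h1
    have h2 : ∑ i, ∑ j, Y i j * (star (w i) / e (g (.inl i)) * (v j / e (g (.inr j)))) =
        ((2 * vnorm w ^ 2 : ℝ) : ℂ) := by
      rw [vnorm_sq]
      push_cast
      rw [Finset.mul_sum]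
      refine Finset.sum_congr rfl fun i _ => ?_
      rw [← Complex.conj_mul']
      nth_rewrite 3 [hw]
      simp only [Matrix.mulVec, dotProduct, Finset.mul_sum, hB, Matrix.of_apply]
      refine Finset.sum_congr rfl fun j _ => ?_
      have := he0' (g (.inl i))
      have := he0' (g (.inr j))
      rw [Complex.star_def]
      field_simp
    rw [h2, Complex.ofReal_re] at h1
    have h3 : vnorm v ^ 2 ≤ 1 := pow_le_one₀ (vnorm_nonneg _) hv
    rw [← sq_le_one_iff₀ (vnorm_nonneg _)]
    linarith
  have h1 := h B e he0 hBn
  simp only [hsq] at h1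
  refine hXY.not_ge (le_trans (le_of_eq ?_) h1)
  rw [← Complex.re_ofReal_mul]
  refine congrArg _ ?_
  push_cast
  simp only [Finset.mul_sum]
  refine Finset.sum_congr rfl fun i _ => Finset.sum_congr rfl fun j _ => ?_
  have := he0' (g (.inl i))
  have := he0' (g (.inr j))
  simp only [hB, Matrix.of_apply]
  field_simp

theorem exists_inner_of_mem_blockCone {m n : ℕ} {ι : Type*} [DecidableEq ι]
    {g : Fin m ⊕ Fin n → ι} {p : (ι → ℝ) × (Fin m → Fin n → ℂ)} (hp : p ∈ blockCone g) :
    ∃ w : Fin m ⊕ Fin n → EuclideanSpace ℂ (Fin m ⊕ Fin n),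
      (∀ i j, inner ℂ (w (.inl i)) (w (.inr j)) = p.2 i j) ∧
      ∀ k, ∑ x, (if g x = k then ‖w x‖ ^ 2 else 0) ≤ p.1 k := by
  obtain ⟨M, hM, hMp, hMk⟩ := hp
  obtain ⟨A, rfl⟩ := exists_eq_conjTranspose_mul_self hM
  refine ⟨fun x => WithLp.toLp 2 fun y => A y x, fun i j => ?_, fun k => ?_⟩
  · rw [← hMp, Matrix.mul_apply]
    simp [PiLp.inner_apply, mul_comm]
  · simpa only [conjTranspose_mul_self_diag_re, EuclideanSpace.norm_sq_eq] using hMk k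

theorem exists_isSchurFact {m n : ℕ} (X : Matrix (Fin m) (Fin n) ℂ) :
    ∃ (F : Matrix (Fin m) (Fin m) ℂ) (W : Matrix (Fin m) (Fin n) ℂ)
      (G : Matrix (Fin n) (Fin n) ℂ), IsSchurFact X F W G := by
  set s := schurNorm X with hs
  have hs0 : 0 ≤ s := (opNorm_nonneg _).trans <| schurNorm_bound X (B := 0) <|
    (opNorm_le_frobNorm _).trans (by simp [frobNorm])
  have hmem : (fun _ => s, fun i j => X i j) ∈ blockCone (id : Fin m ⊕ Fin n → _) := by
    refine mem_blockCone_of_bilinear_le fun B e _ hB => ?_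
    set a : Fin m → ℂ := fun i => e (.inl i) with ha
    set b : Fin n → ℂ := fun j => e (.inr j) with hb
    have h1 : ∑ i, ∑ j, X i j * B i j * ((e (id (.inl i)) : ℂ) * e (id (.inr j))) =
        ∑ i, a i * (Matrix.hadamard X B *ᵥ b) i := by
      simp only [Matrix.mulVec, dotProduct, Finset.mul_sum, Matrix.hadamard_apply, id, ha, hb]
      exact Finset.sum_congr rfl fun _ _ => Finset.sum_congr rfl fun _ _ => by ring
    have h2 : (∑ i, a i * (Matrix.hadamard X B *ᵥ b) i).re ≤ vnorm a * (s * vnorm b) := by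
      refine (Complex.re_le_norm _).trans ((norm_sum_mul_le _ _).trans ?_)
      refine mul_le_mul_of_nonneg_left ((vnorm_mulVec_le _ _).trans ?_) (vnorm_nonneg _)
      exact mul_le_mul_of_nonneg_right (schurNorm_bound X hB) (vnorm_nonneg _)
    have h3 : ∑ k, e k ^ 2 * s = s * (vnorm a ^ 2 + vnorm b ^ 2) := by
      rw [vnorm_sq, vnorm_sq, ← Finset.sum_mul, Fintype.sum_sum_type, mul_comm]
      simp [ha, hb]
    rw [h1, h3]
    nlinarith [mul_nonneg hs0 (sq_nonneg (vnorm a - vnorm b))]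
  obtain ⟨w, hw, hws⟩ := exists_inner_of_mem_blockCone hmem
  simp only [id, Finset.sum_ite_eq', Finset.mem_univ, if_true] at hw hws
  set z : Fin m ⊕ Fin n → EuclideanSpace ℂ (Fin m ⊕ Fin n) := fun x => ((√s)⁻¹ : ℝ) • w x with hz
  have hz1 (x) : ((‖z x‖ ^ 2 : ℝ) : ℂ) ≤ 1 := by
    rw [← Complex.ofReal_one, Complex.real_le_real, hz, norm_smul, mul_pow, norm_inv, inv_pow,
      Real.norm_of_nonneg (Real.sqrt_nonneg _), Real.sq_sqrt hs0]
    exact (mul_le_mul_of_nonneg_left (hws x) (inv_nonneg.mpr hs0)).trans inv_mul_le_one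
  obtain ⟨F, W, G, d, L, R, hF, hG, hW, hX, -, hFF, hGG, hL, hR⟩ :=
    exists_factorization_of_inner (fun i => z (.inl i)) (fun j => z (.inr j))
      (X := Matrix.of fun i j => inner ℂ (z (.inl i)) (z (.inr j))) fun i j => rfl
  refine ⟨F, W, G, hF, fun i => ?_, hG, fun j => ?_, hW, ?_⟩
  · rw [hFF]; exact (hL i).trans (hz1 _)
  · rw [hGG]; exact (hR j).trans (hz1 _)
  · rw [← hX, ← hs]
    ext i j
    rw [Matrix.smul_apply, Matrix.of_apply, hz]
    simp only [← Complex.coe_smul, inner_smul_left, inner_smul_right, hw, Complex.conj_ofReal,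
      smul_eq_mul]
    rcases hs0.eq_or_lt with h | h
    · have hw0 : w (.inl i) = 0 := by
        have := hws (.inl i)
        rw [← h] at this
        exact norm_eq_zero.mp (pow_eq_zero_iff two_ne_zero |>.mp (this.antisymm (sq_nonneg _)))
      rw [← hw, hw0, inner_zero_left]
      simp
    · have h1 : (s : ℂ) = √s * √s := by exact_mod_cast (Real.mul_self_sqrt hs0).symm
      have h2 : (√s : ℂ) ≠ 0 := by exact_mod_cast (Real.sqrt_pos.mpr h).ne'
      rw [h1]
      push_cast
      field_simp

theorem exists_isBilinSchurFact {m n : ℕ} (X : Matrix (Fin m) (Fin n) ℂ) :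
    ∃ (T : Matrix (Fin m) (Fin m) ℂ) (W : Matrix (Fin m) (Fin n) ℂ)
      (G : Matrix (Fin n) (Fin n) ℂ), IsBilinSchurFact X T W G := by
  set t := Tnorm X with ht
  have ht0 : 0 ≤ t := (vnorm_nonneg _).trans <| Tnorm_bound X (B := 0) <|
    (opNorm_le_frobNorm _).trans (by simp [frobNorm])
  have hmem : (Sum.elim (fun _ => t ^ 2) (fun _ => 1), fun i j => X i j) ∈
      blockCone (Sum.map (fun _ => ()) id : Fin m ⊕ Fin n → Unit ⊕ Fin n) := by
    refine mem_blockCone_of_bilinear_le fun B e he hB => ?_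
    set b : Fin n → ℂ := fun j => e (.inr j) with hb
    have h1 : ∑ i, ∑ j, X i j * B i j * ((e (Sum.map (fun _ => ()) id (.inl i : Fin m ⊕ Fin n)) : ℂ)
          * e (Sum.map (fun _ => ()) id (.inr j : Fin m ⊕ Fin n))) =
        e (.inl ()) * ∑ j, b j * ∑ i, X i j * B i j := by
      simp only [Finset.mul_sum, Sum.map_inl, Sum.map_inr, id, hb]
      rw [Finset.sum_comm]
      exact Finset.sum_congr rfl fun _ _ => Finset.sum_congr rfl fun _ _ => by ring
    have h2 : (∑ j, b j * ∑ i, X i j * B i j).re ≤ vnorm b * t := by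
      refine (Complex.re_le_norm _).trans ((norm_sum_mul_le _ _).trans ?_)
      exact mul_le_mul_of_nonneg_left (Tnorm_bound X hB) (vnorm_nonneg _)
    have h3 : ∑ k, e k ^ 2 * (Sum.elim (fun _ => t ^ 2) (fun _ => 1) : Unit ⊕ Fin n → ℝ) k =
        e (.inl ()) ^ 2 * t ^ 2 + vnorm b ^ 2 := by
      rw [vnorm_sq, Fintype.sum_sum_type]
      simp [hb]
    rw [h1, h3, Complex.re_ofReal_mul]
    have h4 := mul_le_mul_of_nonneg_left h2 (he (.inl ())).le
    nlinarith [sq_nonneg (e (.inl ()) * t - vnorm b)]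
  obtain ⟨w, hw, hws⟩ := exists_inner_of_mem_blockCone hmem
  have hu : ∑ i, ‖w (.inl i)‖ ^ 2 ≤ t ^ 2 := by simpa using hws (.inl ())
  have hv (j) : ((‖w (.inr j)‖ ^ 2 : ℝ) : ℂ) ≤ 1 := by
    rw [← Complex.ofReal_one, Complex.real_le_real]
    simpa using hws (.inr j)
  obtain ⟨F, W, G, d, L, R, hF, hG, hW, hX, hXLR, hFF, hGG, hL, hR⟩ :=
    exists_factorization_of_inner (fun i => w (.inl i)) (fun j => w (.inr j)) (X := X) hw
  have hLt : frobNorm L ≤ t := by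
    refine (sq_le_sq₀ (frobNorm_nonneg _) ht0).mp (le_trans ?_ hu)
    rw [frobNorm_sq]
    refine Finset.sum_le_sum fun i _ => ?_
    have := (Complex.le_def.mp (hL i)).1
    rw [Complex.ofReal_re] at this
    rwa [mul_conjTranspose_self_diag_re] at this
  have hFL : frobNorm F = frobNorm L := by
    refine (sq_eq_sq₀ (frobNorm_nonneg _) (frobNorm_nonneg _)).mp ?_
    rw [frobNorm_sq, frobNorm_sq]
    refine Finset.sum_congr rfl fun i _ => ?_
    rw [← mul_conjTranspose_self_diag_re F, ← mul_conjTranspose_self_diag_re L, hF.1.eq, hFF]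
  have hGd (j) : (G * G) j j ≤ 1 := by rw [hGG]; exact (hR j).trans (hv j)
  refine ⟨F, W, G, hF, ?_, hG, hGd, hW, hX⟩
  rw [hFL]
  exact hLt.antisymm (Tnorm_le_frobNorm hXLR fun j => (hR j).trans (hv j))

theorem stmt8 {m n : ℕ} (X : Matrix (Fin m) (Fin n) ℂ) :
    (∃ (F : Matrix (Fin m) (Fin m) ℂ) (W : Matrix (Fin m) (Fin n) ℂ)
      (G : Matrix (Fin n) (Fin n) ℂ), IsSchurFact X F W G) ∧
    (∃ (T : Matrix (Fin m) (Fin m) ℂ) (W' : Matrix (Fin m) (Fin n) ℂ)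
      (G' : Matrix (Fin n) (Fin n) ℂ), IsBilinSchurFact X T W' G') :=
  ⟨exists_isSchurFact X, exists_isBilinSchurFact X⟩

end MatFact
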